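/- Let R be a commutative ring, let n be a finite index type, let f, g be n×n matrices over R, and suppose f is invertible with inverse f⁻¹. Consider the matrix M = f + ε·g over the dual numbers R[ε] (ε² = 0), i.e. the matrix whose (i,j)-entry is the dual number (f i j, g i j). Then det(M) = det(f)·(1 + ε·Tr(f⁻¹·g)) in R[ε]; equivalently, det(M) is the dual number (det f, det(f)·Tr(f⁻¹·g)). -/

import Mathlib

open TrivSqZeroExt DualNumber Matrix

/-- The identity `det(f + εg) = det(f)·(1 + ε·Tr(f⁻¹g))` for matrices over
the dual numbers `R[ε]` (with `ε² = 0`), used in the infinitesimal study of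
anti-invariant vector bundles (Section 3.2.2 of the paper). -/
theorem dualNumber_matrix_det {R : Type*} [CommRing R]
    {n : Type*} [Fintype n] [DecidableEq n]
    (f g finv : Matrix n n R) (hf : f * finv = 1) (hf' : finv * f = 1) :
    (f.map (inl : R → DualNumber R) +
        (eps : DualNumber R) • g.map (inl : R → DualNumber R)).det
      = inl f.det * (1 + (eps : DualNumber R) * inl (finv * g).trace) := by
  let φ : R →+* DualNumber R := inlHom R R
  have h_factor : φ.mapMatrix f + (eps : DualNumber R) • φ.mapMatrix g =
      φ.mapMatrix f * (1 + (eps : DualNumber R) • φ.mapMatrix (finv * g)) := by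
    rw [mul_add, mul_one, mul_smul_comm, ← map_mul, ← mul_assoc, hf, one_mul]
  have h_trace : (φ.mapMatrix (finv * g)).trace = φ (finv * g).trace :=
    (AddMonoidHom.map_trace φ.toAddMonoidHom (finv * g)).symm
  change (φ.mapMatrix f + (eps : DualNumber R) • φ.mapMatrix g).det =
    φ f.det * (1 + (eps : DualNumber R) * φ (finv * g).trace)
  rw [h_factor, det_mul, det_one_add_smul, ← RingHom.map_det, h_trace, pow_two, eps_mul_eps,
    mul_zero, add_zero, mul_comm (φ (finv * g).trace)]
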